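/- Equidistribution of vincular pattern pairs: For every n ≥ 0 and all nonnegative integers a and b, the number of permutations σ of [n] with (2–13)(σ) = a and (31–2)(σ) = b equals the number of permutations σ of [n] with (2–31)(σ) = a and (31–2)(σ) = b; that is, the pairs of statistics (2–13, 31–2) and (2–31, 31–2) are equidistributed on S_n. -/

import Mathlib

/-- The word `σ₁ ⋯ σ_n` (0-indexed here) of a permutation of `{0, …, n−1}`. -/
def permWord {n : ℕ} (σ : Equiv.Perm (Fin n)) : List ℕ :=
  List.ofFn fun i => (σ i : ℕ)

/-- The total number of occurrences of the vincular pattern 2–13 in the word `w`: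
pairs of positions `(i, j)` (0-indexed) with `i < j`, `j + 1 < n` and `w_j < w_i < w_{j+1}`. -/
def tot213 (w : List ℕ) : ℕ :=
  ((Finset.range w.length ×ˢ Finset.range w.length).filter fun p =>
    p.1 < p.2 ∧ p.2 + 1 < w.length ∧
      w.getD p.2 0 < w.getD p.1 0 ∧ w.getD p.1 0 < w.getD (p.2 + 1) 0).card

/-- The total number of occurrences of the vincular pattern 31–2 in the word `w`:
pairs of positions `(j, i)` (0-indexed) with `j + 1 < i < n` and `w_{j+1} < w_i < w_j`. -/
def tot312 (w : List ℕ) : ℕ :=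
  ((Finset.range w.length ×ˢ Finset.range w.length).filter fun p =>
    p.1 + 1 < p.2 ∧
      w.getD (p.1 + 1) 0 < w.getD p.2 0 ∧ w.getD p.2 0 < w.getD p.1 0).card

/-- The total number of occurrences of the vincular pattern 2–31 in the word `w`:
pairs of positions `(i, j)` (0-indexed) with `i < j`, `j + 1 < n` and `w_{j+1} < w_i < w_j`. -/
def tot231 (w : List ℕ) : ℕ :=
  ((Finset.range w.length ×ˢ Finset.range w.length).filter fun p =>
    p.1 < p.2 ∧ p.2 + 1 < w.length ∧
      w.getD (p.2 + 1) 0 < w.getD p.1 0 ∧ w.getD p.1 0 < w.getD p.2 0).card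

set_option linter.all false

namespace Vinc

def cr (e : Bool) (x : ℕ) : List ℕ → ℕ
  | [] => 0
  | [_] => 0
  | u :: v :: l =>
    (if (if e then v < x ∧ x < u else u < x ∧ x < v) then 1 else 0) + cr e x (v :: l)

def st (e : Bool) : List ℕ → ℕ
  | [] => 0
  | x :: l => cr e x l + st e l

def sC (l : List ℕ) : ℕ := st false l.reverse

theorem cr_zero_e (l : List ℕ) : cr false 0 l = 0 := by
  induction l with
  | nil => rfl
  | cons u l ih =>
    cases l with
    | nil => rfl
    | cons v l => simp [cr, ih]

theorem cr_zero (e : Bool) (l : List ℕ) : cr e 0 l = 0 := by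
  induction l with
  | nil => rfl
  | cons u l ih =>
    cases l with
    | nil => rfl
    | cons v l => simp [cr, ih]

theorem cr_replace (e : Bool) (x k : ℕ) (h : k < x) (X Y : List ℕ) :
    cr e x (X ++ k :: Y) = cr e x (X ++ 0 :: Y) := by
  induction X with
  | nil =>
    cases Y with
    | nil => rfl
    | cons v l => cases e <;> simp [cr] <;> grind
  | cons u X ih =>
    cases X with
    | nil => simp only [List.cons_append, List.nil_append, cr] at ih ⊢; rw [ih]; cases e <;> simp <;> grind
    | cons v X => simp only [List.cons_append, cr] at ih ⊢; rw [ih]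

theorem cr_dup (e : Bool) (x : ℕ) (X Y : List ℕ) :
    cr e x (X ++ 0 :: 0 :: Y) = cr e x (X ++ 0 :: Y) := by
  induction X with
  | nil =>
    cases e <;> simp [cr]
  | cons u X ih =>
    cases X with
    | nil => simp only [List.cons_append, List.nil_append, cr] at ih ⊢; rw [ih]
    | cons v X => simp only [List.cons_append, cr] at ih ⊢; rw [ih]

theorem st_replace (e : Bool) (k : ℕ) (X Y : List ℕ) (hX : ∀ x ∈ X, x = 0 ∨ k < x) :
    st e (X ++ k :: Y) = st e (X ++ 0 :: Y) + cr e k Y := by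
  induction X with
  | nil => simp [st, cr_zero]; omega
  | cons u X ih =>
    simp only [List.cons_append, st]
    rw [ih (fun x hx => hX x (by simp [hx]))]
    rcases hX u (by simp) with h | h
    · subst h; simp [cr_zero]
    · rw [cr_replace e u k h]; omega

theorem st_dup (e : Bool) (X Y : List ℕ) :
    st e (X ++ 0 :: 0 :: Y) = st e (X ++ 0 :: Y) := by
  induction X with
  | nil => simp [st, cr_zero]
  | cons u X ih => simp only [List.cons_append, st, ih, cr_dup]

theorem sC_dup (X Y : List ℕ) :
    sC (X ++ 0 :: 0 :: Y) = sC (X ++ 0 :: Y) := by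
  simp only [sC, List.reverse_append, List.reverse_cons, List.append_assoc, List.cons_append, List.nil_append]
  exact st_dup _ _ _

theorem cr_append (e : Bool) (x u v : ℕ) (l : List ℕ) : cr e x (l ++ [u, v]) =
    cr e x (l ++ [u]) + (if (if e then v < x ∧ x < u else u < x ∧ x < v) then 1 else 0) := by
  induction l with
  | nil => simp [cr]
  | cons w l ih =>
    cases l with
    | nil => simp [cr]
    | cons y l => simp only [List.cons_append, cr] at ih ⊢; rw [ih]; omega

theorem cr_reverse (x : ℕ) (l : List ℕ) : cr false x l.reverse = cr true x l := by
  induction l with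
  | nil => rfl
  | cons u l ih =>
    cases l with
    | nil => rfl
    | cons v l =>
      simp only [List.reverse_cons, List.append_assoc, List.cons_append, List.nil_append] at ih ⊢
      rw [cr_append, ih]; simp [cr]; omega

theorem sC_replace (k : ℕ) (X Y : List ℕ) (hY : ∀ x ∈ Y, x = 0 ∨ k < x) :
    sC (X ++ k :: Y) = sC (X ++ 0 :: Y) + cr true k X := by
  simp only [sC, List.reverse_append, List.reverse_cons, List.append_assoc, List.cons_append, List.nil_append]
  rw [st_replace, cr_reverse]
  simpa using hY

def fl (e : Bool) (L : List (List ℕ)) : List ℕ :=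
  L.flatMap (fun u => 0 :: u) ++ (if e then [] else [0])

def Good (k : ℕ) (L : List (List ℕ)) : Prop := ∀ u ∈ L, u ≠ [] ∧ ∀ x ∈ u, k < x

theorem cr_hi (e : Bool) (k : ℕ) (b : List ℕ) (hb : ∀ x ∈ b, k < x) (h0 : b ≠ []) (Z : List ℕ) :
    cr e k (b ++ 0 :: Z) = (if e && decide (0 < k) then 1 else 0) + cr e k (0 :: Z) := by
  induction b with
  | nil => simp at h0
  | cons u b ih =>
    cases b with
    | nil => 
      have := hb u (by simp)
      cases e <;> simp [cr] <;> grind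
    | cons v b => 
      have h1 := hb u (by simp)
      have h2 := hb v (by simp)
      have := ih (fun x hx => hb x (by simp [hx])) (by simp)
      simp only [List.cons_append, cr] at this ⊢
      rw [this]
      cases e <;> simp [cr] <;> grind

theorem cr_hi' (e : Bool) (k : ℕ) (b : List ℕ) (hb : ∀ x ∈ b, k < x) : cr e k b = 0 := by
  induction b with
  | nil => rfl
  | cons u b ih =>
    cases b with
    | nil => rfl
    | cons v b => 
      have h1 := hb u (by simp)
      have h2 := hb v (by simp)
      have := ih (fun x hx => hb x (by simp [hx]))
      simp only [cr] at this ⊢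
      rw [this]
      cases e <;> simp <;> grind

theorem cr_lo (e : Bool) (k : ℕ) (hk : 0 < k) (b : List ℕ) (hb : ∀ x ∈ b, k < x) (h0 : b ≠ []) (Z : List ℕ) :
    cr e k (0 :: (b ++ Z)) = (if e then 0 else 1) + cr e k (b ++ Z) := by
  cases b with
  | nil => simp at h0
  | cons u b =>
    have h1 := hb u (by simp)
    cases e <;> simp [cr] <;> grind

/-- value of fl, starting with `0` -/
theorem cr_fl (e : Bool) (k : ℕ) (hk : 0 < k) (Q : List (List ℕ)) (hQ : Good k Q) :
    cr e k (fl e Q) = if e then Q.length - 1 else Q.length := by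
  induction Q with
  | nil => cases e <;> rfl
  | cons u Q ih =>
    have hu := hQ u (by simp)
    have ih := ih (fun v hv => hQ v (by simp [hv]))
    have : fl e (u :: Q) = 0 :: (u ++ fl e Q) := by simp [fl]
    rw [this, cr_lo e k hk u hu.2 hu.1]
    cases Q with
    | nil =>
      cases e
      · have := cr_hi false k u hu.2 hu.1 []
        simp [fl, this, cr]
      · simp [fl, cr_hi' true k u hu.2]
    | cons v Q =>
      have h3 : fl e (v :: Q) = 0 :: (v ++ fl e Q) := by simp [fl]
      rw [h3] at ih ⊢
      rw [cr_hi e k u hu.2 hu.1, ih]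
      cases e <;> simp [hk] <;> omega

theorem cr_Y (e : Bool) (k : ℕ) (hk : 0 < k) (b : List ℕ) (hb : ∀ x ∈ b, k < x)
    (Q : List (List ℕ)) (hQ : Good k Q) :
    cr e k (b ++ fl e Q) = if e = true ∧ b = [] then Q.length - 1 else Q.length := by
  by_cases h0 : b = []
  · subst h0; simp [cr_fl e k hk Q hQ]
  · cases Q with
    | nil =>
      cases e
      · have := cr_hi false k b hb h0 []
        simp [fl, this, cr]
      · simp [fl, cr_hi' true k b hb]
    | cons v Q =>
      have h3 : fl e (v :: Q) = 0 :: (v ++ fl e Q) := by simp [fl]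
      have h4 := cr_fl e k hk _ hQ
      rw [h3] at h4 ⊢
      rw [cr_hi e k b hb h0, h4]
      cases e <;> simp [hk, h0] <;> omega

theorem cr_X (k : ℕ) (hk : 0 < k) (a : List ℕ) (ha : ∀ x ∈ a, k < x)
    (P : List (List ℕ)) (hP : Good k P) :
    cr true k (P.flatMap (fun u => 0 :: u) ++ 0 :: a) = P.length := by
  induction P with
  | nil =>
    cases a with
    | nil => rfl
    | cons u a => simp [cr]; exact cr_hi' _ _ _ ha
  | cons u P ih =>
    have hu := hP u (by simp)
    have ih := ih (fun v hv => hP v (by simp [hv]))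
    have : (List.flatMap (fun u => 0 :: u) (u :: P) ++ 0 :: a) =
      0 :: (u ++ (P.flatMap (fun u => 0 :: u) ++ 0 :: a)) := by simp
    rw [this, cr_lo true k hk u hu.2 hu.1]
    obtain ⟨Z, hZ⟩ : ∃ Z, P.flatMap (fun u => 0 :: u) ++ 0 :: a = 0 :: Z := by
      cases P <;> simp
    rw [hZ] at ih ⊢
    rw [cr_hi true k u hu.2 hu.1, ih]
    simp [hk]; omega

def seg (a : List ℕ) : List (List ℕ) := if a = [] then [] else [a]

theorem fl_append (e : Bool) (P Q : List (List ℕ)) :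
    fl e (P ++ Q) = P.flatMap (fun u => 0 :: u) ++ fl e Q := by simp [fl]

theorem stat_step (e : Bool) (k : ℕ) (hk : 0 < k) (P Q : List (List ℕ)) (a b : List ℕ)
    (hP : Good k P) (hQ : Good k Q) (ha : ∀ x ∈ a, k < x) (hb : ∀ x ∈ b, k < x)
    (hbQ : e = true → b = [] → Q ≠ []) :
    st e (fl e (P ++ (a ++ k :: b) :: Q)) = st e (fl e (P ++ (seg a ++ (seg b ++ Q)))) +
        (if e = true ∧ b = [] then Q.length - 1 else Q.length) ∧
    sC (fl e (P ++ (a ++ k :: b) :: Q)) = sC (fl e (P ++ (seg a ++ (seg b ++ Q)))) + P.length := by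
  set X := P.flatMap (fun u => 0 :: u) ++ 0 :: a with hXdef
  set Y := b ++ fl e Q with hYdef
  have hL : fl e (P ++ (a ++ k :: b) :: Q) = X ++ k :: Y := by
    simp [fl, hXdef, hYdef]
  have hX : ∀ x ∈ X, x = 0 ∨ k < x := by
    intro x hx
    simp only [hXdef, List.mem_append, List.mem_flatMap, List.mem_cons] at hx
    rcases hx with ⟨u, hu, rfl | hx⟩ | rfl | hx
    · simp
    · exact Or.inr ((hP u hu).2 x hx)
    · simp
    · exact Or.inr (ha x hx)
  have hY : ∀ x ∈ Y, x = 0 ∨ k < x := by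
    intro x hx
    simp only [hYdef, fl, List.mem_append, List.mem_flatMap, List.mem_cons] at hx
    rcases hx with hx | ⟨u, hu, rfl | hx⟩ | hx
    · exact Or.inr (hb x hx)
    · simp
    · exact Or.inr ((hQ u hu).2 x hx)
    · left; cases e <;> simp_all
  have main : st e (X ++ 0 :: Y) = st e (fl e (P ++ (seg a ++ (seg b ++ Q)))) ∧
      sC (X ++ 0 :: Y) = sC (fl e (P ++ (seg a ++ (seg b ++ Q)))) := by
    have hB : ∀ Z, st e (Z ++ 0 :: Y) = st e (Z ++ fl e (seg b ++ Q)) ∧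
        sC (Z ++ 0 :: Y) = sC (Z ++ fl e (seg b ++ Q)) := by
      intro Z
      by_cases h : b = []
      · obtain ⟨Y', hY'⟩ : ∃ Y', fl e Q = 0 :: Y' := by
          cases Q with
          | nil => cases e
                   · exact ⟨[], rfl⟩
                   · simp_all
          | cons v Q => exact ⟨_, by simp only [fl, List.flatMap_cons, List.cons_append]; rfl⟩
        simp only [hYdef, h, seg, List.nil_append, if_true, hY']
        exact ⟨st_dup _ _ _, sC_dup _ _⟩
      · have : fl e (seg b ++ Q) = 0 :: Y := by simp [seg, h, fl, hYdef]
        rw [this]; simp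
    by_cases h : a = []
    · have h5 : X ++ 0 :: Y = P.flatMap (fun u => 0 :: u) ++ 0 :: 0 :: Y := by simp [hXdef, h]
      rw [h5, st_dup, sC_dup, fl_append e P]
      simp only [seg, h, if_true, List.nil_append]
      exact hB _
    · rw [fl_append e P, show seg a = [a] by simp [seg, h], fl_append e [a], ← List.append_assoc]
      convert hB X using 4 <;> simp [hXdef]
  rw [hL, st_replace e k X Y hX, sC_replace k X Y hY, main.1, main.2, cr_Y e k hk b hb Q hQ, cr_X k hk a ha P hP]
  exact ⟨rfl, rfl⟩

def prd (e : Bool) (x u v : ℕ) : Prop := if e then v < x ∧ x < u else u < x ∧ x < v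

instance (e : Bool) (x u v : ℕ) : Decidable (prd e x u v) := by unfold prd; infer_instance

theorem cr_sum (e : Bool) (x : ℕ) (l : List ℕ) : cr e x l =
    ∑ j ∈ Finset.range l.length, if j + 1 < l.length ∧ prd e x (l.getD j 0) (l.getD (j+1) 0) then 1 else 0 := by
  induction l with
  | nil => rfl
  | cons u l ih =>
    cases l with
    | nil => simp [cr]
    | cons v l =>
      rw [cr, ih, List.length_cons (a := u), Finset.sum_range_succ', add_comm]
      simp only [List.getD_cons_succ, List.getD_cons_zero, List.length_cons, prd, Nat.add_lt_add_iff_right]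
      simp

theorem st_sum (e : Bool) (l : List ℕ) : st e l =
    ∑ i ∈ Finset.range l.length, ∑ j ∈ Finset.range l.length,
      if i < j ∧ j + 1 < l.length ∧ prd e (l.getD i 0) (l.getD j 0) (l.getD (j+1) 0) then 1 else 0 := by
  induction l with
  | nil => rfl
  | cons u l ih =>
    rw [st, ih, List.length_cons, Finset.sum_range_succ']
    simp only [Finset.sum_range_succ' _ l.length]
    simp only [List.getD_cons_succ, List.getD_cons_zero, Nat.add_lt_add_iff_right, add_comm (cr _ _ _), not_lt_zero, false_and, if_false, add_zero, Nat.zero_lt_succ, true_and]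
    rw [cr_sum]

theorem tot213_eq (l : List ℕ) : tot213 l = st false l := by
  rw [st_sum, tot213, Finset.card_filter, Finset.sum_product]
  simp [prd]

theorem tot231_eq (l : List ℕ) : tot231 l = st true l := by
  rw [st_sum, tot231, Finset.card_filter, Finset.sum_product]
  simp [prd]

theorem tot312_eq (l : List ℕ) : tot312 l = sC l := by
  rw [sC, ← tot213_eq, tot312, tot213]
  have hr : ∀ i, i < l.length → l.reverse.getD i 0 = l.getD (l.length - 1 - i) 0 := by
    intro i hi
    simp [List.getD_eq_getElem?_getD, List.getElem?_reverse hi]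
  refine Finset.card_bij' (fun p _ => (l.length - 1 - p.2, l.length - 1 - (p.1 + 1)))
    (fun p _ => (l.length - 1 - (p.2 + 1), l.length - 1 - p.1)) ?_ ?_ ?_ ?_
  · rintro ⟨j, i⟩ h
    simp only [Finset.mem_filter, Finset.mem_product, Finset.mem_range, List.length_reverse] at h ⊢
    obtain ⟨⟨h1, h2⟩, h3, h4⟩ := h
    rw [hr _ (by omega), hr _ (by omega), hr _ (by omega)]
    rw [show l.length - 1 - (l.length - 1 - (j+1)) = j + 1 by omega,
      show l.length - 1 - (l.length - 1 - i) = i by omega,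
      show l.length - 1 - (l.length - 1 - (j+1) + 1) = j by omega]
    refine ⟨by omega, by omega, by omega, h4⟩
  · rintro ⟨i, j⟩ h
    simp only [Finset.mem_filter, Finset.mem_product, Finset.mem_range, List.length_reverse] at h ⊢
    obtain ⟨⟨h1, h2⟩, h3, h4, h5⟩ := h
    rw [hr _ (by omega), hr _ (by omega), hr _ (by omega)] at h5
    rw [show l.length - 1 - (j+1) + 1 = l.length - 1 - j by omega]
    refine ⟨by omega, by omega, h5⟩
  · rintro ⟨j, i⟩ h
    simp only [Finset.mem_filter, Finset.mem_product, Finset.mem_range, List.length_reverse] at h ⊢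
    ext <;> simp <;> omega
  · rintro ⟨j, i⟩ h
    simp only [Finset.mem_filter, Finset.mem_product, Finset.mem_range, List.length_reverse] at h ⊢
    ext <;> simp <;> omega

theorem cr_map (e : Bool) (x : ℕ) (l : List ℕ) : cr e (x+1) (l.map (· + 1)) = cr e x l := by
  induction l with
  | nil => rfl
  | cons u l ih =>
    cases l with
    | nil => rfl
    | cons v l => simp only [List.map_cons, cr, ih, Nat.add_lt_add_iff_right] at ih ⊢; rw [ih]

theorem st_map (e : Bool) (l : List ℕ) : st e (l.map (· + 1)) = st e l := by
  induction l with
  | nil => rfl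
  | cons u l ih => simp only [List.map_cons, st, ih, cr_map]

theorem sC_map (l : List ℕ) : sC (l.map (· + 1)) = sC l := by
  rw [sC, ← List.map_reverse, st_map, sC]

/- boundary effects -/
theorem st_cons_zero (e : Bool) (l : List ℕ) : st e (0 :: l) = st e l := by
  simp [st, cr_zero]

theorem cr_concat (e : Bool) (x z : ℕ) (l : List ℕ) (h : if e then x ≤ z else z ≤ x) :
    cr e x (l ++ [z]) = cr e x l := by
  induction l with
  | nil => rfl
  | cons u l ih =>
    cases l with
    | nil => cases e <;> simp [cr] at h ⊢ <;> omega
    | cons v l => simp only [List.cons_append, cr] at ih ⊢; rw [ih]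

theorem st_concat (e : Bool) (z : ℕ) (l : List ℕ) (h : ∀ x ∈ l, if e then x ≤ z else z ≤ x) :
    st e (l ++ [z]) = st e l := by
  induction l with
  | nil => rfl
  | cons u l ih =>
    simp only [List.cons_append, st]
    rw [ih (fun x hx => h x (by simp [hx])), cr_concat e u z l (h u (by simp))]

theorem cr_big (e : Bool) (x : ℕ) (l : List ℕ) (h : ∀ u ∈ l, u ≤ x) : cr e x l = 0 := by
  induction l with
  | nil => rfl
  | cons u l ih =>
    cases l with
    | nil => rfl
    | cons v l => 
      have h1 := h u (by simp)
      have h2 := h v (by simp)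
      rw [cr, ih (fun x hx => h x (by simp [hx]))]
      cases e <;> simp <;> omega

theorem stats_A (w : List ℕ) : st false (fl false [w.map (· + 1)]) = tot213 w ∧
    sC (fl false [w.map (· + 1)]) = tot312 w := by
  have h : fl false [w.map (· + 1)] = 0 :: (w.map (· + 1) ++ [0]) := by simp [fl]
  rw [h]
  constructor
  · rw [st_cons_zero, st_concat _ _ _ (by simp), st_map, tot213_eq]
  · rw [tot312_eq, ← sC_map w, sC, sC]
    simp only [List.reverse_cons, List.reverse_append, List.cons_append, List.reverse_nil, List.nil_append]
    rw [st_cons_zero, st_concat _ _ _ (by simp)]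

theorem stats_B (w : List ℕ) (n : ℕ) (hw : ∀ x ∈ w, x < n) : st true (fl true [w.map (· + 1) ++ [n+1]]) = tot231 w ∧
    sC (fl true [w.map (· + 1) ++ [n+1]]) = tot312 w := by
  have h : fl true [w.map (· + 1) ++ [n+1]] = 0 :: (w.map (· + 1) ++ [n+1]) := by simp [fl]
  rw [h]
  have h' : ∀ x ∈ w.map (· + 1), x ≤ n + 1 := by
    intro x hx; simp at hx; obtain ⟨y, hy, rfl⟩ := hx; have := hw y hy; omega
  constructor
  · rw [st_cons_zero, st_concat _ _ _ (by simpa using fun x hx => (hw x hx).le), st_map, tot231_eq]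
  · rw [tot312_eq, ← sC_map w, sC, sC]
    simp only [List.reverse_cons, List.reverse_append, List.cons_append, List.reverse_nil, List.nil_append]
    rw [st]
    rw [st_concat _ _ _ (by simp), cr_big, zero_add]
    intro u hu
    simp only [List.mem_append, List.mem_reverse, List.mem_singleton] at hu
    rcases hu with hu | rfl
    · exact h' u hu
    · omega

def f1 (k : ℕ) (L : List (List ℕ)) (i : ℕ) : List (List ℕ) :=
  L.take i ++ (L.getD i [] ++ k :: L.getD (i+1) []) :: L.drop (i+2)
def f2 (k : ℕ) (L : List (List ℕ)) (i : ℕ) : List (List ℕ) :=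
  L.take i ++ (k :: L.getD i []) :: L.drop (i+1)
def f3 (k : ℕ) (L : List (List ℕ)) (i : ℕ) : List (List ℕ) :=
  L.take i ++ (L.getD i [] ++ [k]) :: L.drop (i+1)
def f4 (k : ℕ) (L : List (List ℕ)) (i : ℕ) : List (List ℕ) :=
  L.take i ++ [k] :: L.drop i

def step (e : Bool) (k : ℕ) (L : List (List ℕ)) : List (List (List ℕ)) :=
  (List.range (L.length - 1)).map (f1 k L) ++ ((List.range L.length).map (f2 k L) ++
   ((List.range (L.length - e.toNat)).map (f3 k L) ++
    (List.range (L.length + 1 - e.toNat)).map (f4 k L)))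

def W (e : Bool) (N : ℕ) : List ℕ → List (List (List ℕ))
  | [] => [[[N]]]
  | k :: ks => (W e N ks).flatMap (step e k)

theorem split1 (L : List (List ℕ)) (i : ℕ) (h : i < L.length) :
    L = L.take i ++ L.getD i [] :: L.drop (i+1) := by
  rw [List.getD_eq_getElem _ _ h]
  simp

theorem split2 (L : List (List ℕ)) (i : ℕ) (h : i + 1 < L.length) :
    L = L.take i ++ L.getD i [] :: L.getD (i+1) [] :: L.drop (i+2) := by
  rw [List.getD_eq_getElem _ _ h, List.getD_eq_getElem _ _ (by omega)]
  simp

theorem Good.append {k : ℕ} {A B : List (List ℕ)} : Good k (A ++ B) ↔ Good k A ∧ Good k B := by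
  simp only [Good, List.mem_append]
  constructor
  · intro h; exact ⟨fun u hu => h u (Or.inl hu), fun u hu => h u (Or.inr hu)⟩
  · rintro ⟨h1, h2⟩ u (hu | hu)
    · exact h1 u hu
    · exact h2 u hu

theorem Good.cons {k : ℕ} {a : List ℕ} {B : List (List ℕ)} :
    Good k (a :: B) ↔ (a ≠ [] ∧ ∀ x ∈ a, k < x) ∧ Good k B := by
  simp [Good]

section GF
variable {R : Type*} [CommSemiring R] (p q : R)

def wt (e : Bool) (L : List (List ℕ)) : R := p ^ st e (fl e L) * q ^ sC (fl e L)

def br (m : ℕ) : R := ∑ i ∈ Finset.range m, p ^ (m - 1 - i) * q ^ i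

theorem wt_f1 (e : Bool) (k : ℕ) (hk : 0 < k) (L : List (List ℕ)) (hL : Good k L) (i : ℕ)
    (hi : i + 1 < L.length) :
    (f1 k L i).length = L.length - 1 ∧
    wt p q e (f1 k L i) = wt p q e L * (p ^ (L.length - 1 - 1 - i) * q ^ i) := by
  have hs := split2 L i hi
  have hG := hL
  rw [hs] at hG
  rw [Good.append, Good.cons, Good.cons] at hG
  obtain ⟨hP, ha, hb, hQ⟩ := hG
  obtain ⟨h1, h2⟩ := stat_step e k hk (L.take i) (L.drop (i+2)) (L.getD i []) (L.getD (i+1) []) hP hQ ha.2 hb.2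
    (fun _ h => absurd h hb.1)
  have hs' : L.take i ++ (seg (L.getD i []) ++ (seg (L.getD (i+1) []) ++ L.drop (i+2))) = L := by
    simp only [seg, ha.1, hb.1, if_false]; exact hs.symm
  rw [hs'] at h1 h2
  constructor
  · simp [f1]; omega
  · rw [wt, f1, h1, h2, wt]
    simp only [hb.1, and_false, if_false, List.length_drop, List.length_take]
    rw [show min i L.length = i by omega, show L.length - (i+2) = L.length - 1 - 1 - i by omega]
    ring

theorem wt_f2 (e : Bool) (k : ℕ) (hk : 0 < k) (L : List (List ℕ)) (hL : Good k L) (i : ℕ)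
    (hi : i < L.length) :
    (f2 k L i).length = L.length ∧
    wt p q e (f2 k L i) = wt p q e L * (p ^ (L.length - 1 - i) * q ^ i) := by
  have hs := split1 L i hi
  have hG := hL
  rw [hs] at hG
  rw [Good.append, Good.cons] at hG
  obtain ⟨hP, hb, hQ⟩ := hG
  obtain ⟨h1, h2⟩ := stat_step e k hk (L.take i) (L.drop (i+1)) [] (L.getD i []) hP hQ (by simp) hb.2
    (fun _ h => absurd h hb.1)
  have hs' : L.take i ++ (seg [] ++ (seg (L.getD i []) ++ L.drop (i+1))) = L := by
    simp only [seg, hb.1, if_false]; exact hs.symm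
  rw [hs'] at h1 h2
  constructor
  · simp [f2]; omega
  · rw [List.nil_append] at h1 h2
    rw [wt, f2, h1, h2, wt]
    simp only [hb.1, and_false, if_false, List.length_drop, List.length_take]
    rw [show min i L.length = i by omega, show L.length - (i+1) = L.length - 1 - i by omega]
    ring

theorem wt_f3 (e : Bool) (k : ℕ) (hk : 0 < k) (L : List (List ℕ)) (hL : Good k L) (i : ℕ)
    (hi : i < L.length - e.toNat) :
    (f3 k L i).length = L.length ∧
    wt p q e (f3 k L i) = wt p q e L * (p ^ (L.length - e.toNat - 1 - i) * q ^ i) := by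
  have hi' : i < L.length := by omega
  have hs := split1 L i hi'
  have hG := hL
  rw [hs] at hG
  rw [Good.append, Good.cons] at hG
  obtain ⟨hP, ha, hQ⟩ := hG
  obtain ⟨h1, h2⟩ := stat_step e k hk (L.take i) (L.drop (i+1)) (L.getD i []) [] hP hQ ha.2 (by simp)
    (fun h _ h' => by subst h; simp at h' hi; omega)
  have hs' : L.take i ++ (seg (L.getD i []) ++ (seg [] ++ L.drop (i+1))) = L := by
    simp only [seg, ha.1, if_false]; exact hs.symm
  rw [hs'] at h1 h2
  constructor
  · simp [f3]; omega
  · rw [wt, f3, h1, h2, wt]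
    simp only [and_true, List.length_drop, List.length_take]
    rw [show min i L.length = i by omega, show (if e = true then L.length - (i+1) - 1 else L.length - (i+1)) = L.length - e.toNat - 1 - i by cases e <;> simp <;> omega]
    ring

theorem wt_f4 (e : Bool) (k : ℕ) (hk : 0 < k) (L : List (List ℕ)) (hL : Good k L) (i : ℕ)
    (hi : i < L.length + 1 - e.toNat) :
    (f4 k L i).length = L.length + 1 ∧
    wt p q e (f4 k L i) = wt p q e L * (p ^ (L.length + 1 - e.toNat - 1 - i) * q ^ i) := by
  have hi' : i ≤ L.length := by omega
  have hs := (List.take_append_drop i L).symm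
  have hG := hL
  rw [hs] at hG
  rw [Good.append] at hG
  obtain ⟨hP, hQ⟩ := hG
  obtain ⟨h1, h2⟩ := stat_step e k hk (L.take i) (L.drop i) [] [] hP hQ (by simp) (by simp)
    (fun h _ h' => by subst h; simp at h' hi; omega)
  have hs' : L.take i ++ (seg [] ++ (seg [] ++ L.drop i)) = L := by
    simp only [seg]; exact hs.symm
  rw [hs'] at h1 h2
  constructor
  · simp [f4]; omega
  · rw [List.nil_append] at h1 h2
    rw [wt, f4, h1, h2, wt]
    simp only [and_true, List.length_drop, List.length_take]
    rw [show min i L.length = i by omega, show (if e = true then L.length - i - 1 else L.length - i) = L.length + 1 - e.toNat - 1 - i by cases e <;> simp; omega]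
    ring

def ind (e : Bool) (M : ℕ) (L : List (List ℕ)) : R := if L.length = M then wt p q e L else 0

theorem sum_map_range (m : ℕ) (g : ℕ → R) : ((List.range m).map g).sum = ∑ i ∈ Finset.range m, g i := by
  rw [Finset.sum_range, ← List.sum_ofFn, List.ofFn_eq_map]
  congr 1
  rw [← List.map_coe_finRange_eq_range, List.map_map]; rfl

theorem piece (e : Bool) (M m c : ℕ) (w : R) (f : ℕ → List (List ℕ))
    (h : ∀ i < m, (f i).length = c ∧ wt p q e (f i) = w * (p ^ (m - 1 - i) * q ^ i)) :
    (((List.range m).map f).map (ind p q e M)).sum = if c = M then w * br p q m else 0 := by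
  rw [List.map_map, sum_map_range]
  by_cases hc : c = M
  · rw [if_pos hc, br, Finset.mul_sum]
    refine Finset.sum_congr rfl fun i hi => ?_
    rw [Finset.mem_range] at hi
    simp only [Function.comp, ind, (h i hi).1, (h i hi).2, if_pos hc]
  · rw [if_neg hc]
    refine Finset.sum_eq_zero fun i hi => ?_
    rw [Finset.mem_range] at hi
    simp only [Function.comp, ind, (h i hi).1, if_neg hc]

theorem step_sum (e : Bool) (k : ℕ) (hk : 0 < k) (L : List (List ℕ)) (hL : Good k L) (h0 : L ≠ []) (M : ℕ) :
    ((step e k L).map (ind p q e M)).sum =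
      br p q M * (ind p q e (M+1) L + ind p q e M L) +
      br p q (M - e.toNat) * (ind p q e M L + ind p q e (M-1) L) := by
  have hl : 0 < L.length := List.length_pos_iff.2 h0
  simp only [step, List.map_append, List.sum_append]
  rw [piece p q e M _ (L.length - 1) (wt p q e L) _ (fun i hi => wt_f1 p q e k hk L hL i (by omega)),
    piece p q e M _ L.length (wt p q e L) _ (fun i hi => wt_f2 p q e k hk L hL i (by omega)),
    piece p q e M _ L.length (wt p q e L) _ (fun i hi => wt_f3 p q e k hk L hL i (by omega)),
    piece p q e M _ (L.length + 1) (wt p q e L) _ (fun i hi => wt_f4 p q e k hk L hL i (by omega))]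
  have e1 : (if L.length - 1 = M then wt p q e L * br p q (L.length - 1) else 0) =
      br p q M * ind p q e (M+1) L := by
    by_cases h : L.length = M + 1
    · rw [ind, if_pos h, if_pos (by omega), h]; simp [mul_comm]
    · rw [ind, if_neg h, if_neg (by omega)]; simp
  have e2 : (if L.length = M then wt p q e L * br p q L.length else 0) =
      br p q M * ind p q e M L := by
    by_cases h : L.length = M
    · rw [ind, if_pos h, if_pos h, h]; simp [mul_comm]
    · rw [ind, if_neg h, if_neg h]; simp
  have e3 : (if L.length = M then wt p q e L * br p q (L.length - e.toNat) else 0) =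
      br p q (M - e.toNat) * ind p q e M L := by
    by_cases h : L.length = M
    · rw [ind, if_pos h, if_pos h, h]; simp [mul_comm]
    · rw [ind, if_neg h, if_neg h]; simp
  have e4 : (if L.length + 1 = M then wt p q e L * br p q (L.length + 1 - e.toNat) else 0) =
      br p q (M - e.toNat) * ind p q e (M-1) L := by
    by_cases h : L.length + 1 = M
    · rw [if_pos h, ind, if_pos (show L.length = M - 1 by omega), h]; simp [mul_comm]
    · rw [if_neg h, ind, if_neg (show ¬ L.length = M - 1 by omega)]; simp
  rw [e1, e2, e3, e4]
  ring

def gf (e : Bool) : ℕ → ℕ → R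
  | 0, M => if M = 1 then 1 else 0
  | r + 1, M => br p q M * (gf e r (M+1) + gf e r M) +
      br p q (M - e.toNat) * (gf e r M + gf e r (M-1))

theorem br_zero : br p q 0 = 0 := by simp [br]
theorem br_one : br p q 1 = 1 := by simp [br]

theorem gf_rel (r M : ℕ) : gf p q false r M = br p q M * (gf p q true r M + gf p q true r (M+1)) := by
  induction r generalizing M with
  | zero =>
    rcases M with _ | _ | M <;> simp [gf, br_zero, br_one]
  | succ r ih =>
    rcases M with _ | M
    · simp [gf, br_zero]
    · rw [gf, gf, gf]
      simp only [ih, Bool.toNat_false, Bool.toNat_true, Nat.sub_zero, Nat.add_sub_cancel]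
      ring

theorem gf_final (r : ℕ) : gf p q false r 1 = gf p q true (r+1) 1 := by
  rw [gf_rel, gf]; simp [br_zero, br_one, add_comm]
end GF

theorem gf_count_true (r m : ℕ) : gf (1:ℕ) 1 true r (m+1) = r.factorial * r.choose m ∧ gf (1:ℕ) 1 true r 0 = 0 := by
  have hb : ∀ m, br (1:ℕ) 1 m = m := by intro m; simp [br]
  induction r generalizing m with
  | zero => cases m <;> simp [gf]
  | succ r ih =>
    refine ⟨?_, by simp [gf, hb]⟩
    rw [gf, hb, hb, (ih _).1, (ih _).1]
    cases m with
    | zero => simp [Nat.factorial_succ]; ring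
    | succ m =>
      simp only [Bool.toNat_true, Nat.add_sub_cancel]
      rw [(ih _).1]
      have h1 := Nat.add_one_mul_choose_eq r (m+1)
      have h2 := Nat.add_one_mul_choose_eq r m
      rw [Nat.factorial_succ]
      simp only [Nat.choose_succ_succ] at h1 h2 ⊢
      simp only [Nat.succ_eq_add_one] at *
      linear_combination r.factorial * h1.symm + r.factorial * h2.symm

theorem Good.mono {j k : ℕ} (h : j < k) {L : List (List ℕ)} (hL : Good k L) : Good j L :=
  fun u hu => ⟨(hL u hu).1, fun x hx => h.trans ((hL u hu).2 x hx)⟩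

theorem good_split (j : ℕ) (L : List (List ℕ)) (hL : Good j L) (i : ℕ) :
    Good j (L.take i) ∧ Good j (L.drop i) ∧ ∀ x ∈ L.getD i [], j < x := by
  refine ⟨fun u hu => hL u (List.mem_of_mem_take hu), fun u hu => hL u (List.mem_of_mem_drop hu), ?_⟩
  intro x hx
  by_cases h : i < L.length
  · rw [List.getD_eq_getElem _ _ h] at hx
    exact (hL _ (List.getElem_mem h)).2 x hx
  · rw [List.getD_eq_default _ _ (by omega)] at hx
    simp at hx

theorem good_step (e : Bool) (j k : ℕ) (h : j < k) (L : List (List ℕ)) (hL : Good j L) (L' : List (List ℕ))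
    (hL' : L' ∈ step e k L) : Good j L' ∧ L' ≠ [] := by
  have H := good_split j L hL
  simp only [step, List.mem_append, List.mem_map] at hL'
  rcases hL' with ⟨i, -, rfl⟩ | ⟨i, -, rfl⟩ | ⟨i, -, rfl⟩ | ⟨i, -, rfl⟩
  · refine ⟨?_, by simp [f1]⟩
    rw [f1, Good.append, Good.cons]
    refine ⟨(H i).1, ⟨by simp, ?_⟩, (H _).2.1⟩
    intro x hx
    simp only [List.mem_append, List.mem_cons] at hx
    rcases hx with hx | rfl | hx
    · exact (H _).2.2 x hx
    · exact h
    · exact (H _).2.2 x hx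
  · refine ⟨?_, by simp [f2]⟩
    rw [f2, Good.append, Good.cons]
    refine ⟨(H i).1, ⟨by simp, ?_⟩, (H _).2.1⟩
    intro x hx
    simp only [List.mem_cons] at hx
    rcases hx with rfl | hx
    · exact h
    · exact (H _).2.2 x hx
  · refine ⟨?_, by simp [f3]⟩
    rw [f3, Good.append, Good.cons]
    refine ⟨(H i).1, ⟨by simp, ?_⟩, (H _).2.1⟩
    intro x hx
    simp only [List.mem_append, List.mem_singleton] at hx
    rcases hx with hx | rfl
    · exact (H _).2.2 x hx
    · exact h
  · refine ⟨?_, by simp [f4]⟩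
    rw [f4, Good.append, Good.cons]
    exact ⟨(H i).1, ⟨by simp, by simpa using h⟩, (H _).2.1⟩

theorem good_W (e : Bool) (N j : ℕ) (ks : List ℕ) (hj : ∀ k ∈ ks, j < k) (hN : j < N) :
    ∀ L ∈ W e N ks, Good j L ∧ L ≠ [] := by
  induction ks with
  | nil => simp [W, Good, hN]
  | cons k ks ih =>
    intro L hL
    simp only [W, List.mem_flatMap] at hL
    obtain ⟨L0, h0, h1⟩ := hL
    exact good_step e j k (hj k (by simp)) L0 (ih (fun x hx => hj x (by simp [hx])) L0 h0).1 L h1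

theorem W_sum {R : Type*} [CommSemiring R] (p q : R) (e : Bool) (N : ℕ) (ks : List ℕ)
    (h0 : ∀ k ∈ ks, 0 < k) (hN : ∀ k ∈ ks, k < N) (hs : ks.Pairwise (· < ·)) (M : ℕ) :
    ((W e N ks).map (ind p q e M)).sum = gf p q e ks.length M := by
  induction ks generalizing M with
  | nil =>
    cases e <;> simp [W, ind, gf, wt, fl, sC, st, cr, eq_comm]
  | cons k ks ih =>
    rw [List.pairwise_cons] at hs
    have ih := ih (fun x hx => h0 x (by simp [hx])) (fun x hx => hN x (by simp [hx])) hs.2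
    have hg := good_W e N k ks hs.1 (hN k (by simp))
    rw [W, List.length_cons, gf, ← ih, ← ih, ← ih]
    have : ∀ l : List (List (List ℕ)), (∀ L ∈ l, Good k L ∧ L ≠ []) →
        ((l.flatMap (step e k)).map (ind p q e M)).sum = 
        br p q M * ((l.map (ind p q e (M+1))).sum + (l.map (ind p q e M)).sum) +
      br p q (M - e.toNat) * ((l.map (ind p q e M)).sum + (l.map (ind p q e (M-1))).sum) := by
      intro l hl
      induction l with
      | nil => simp
      | cons L l ihl =>
        simp only [List.flatMap_cons, List.map_append, List.sum_append, List.map_cons, List.sum_cons]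
        rw [ihl (fun L hL => hl L (by simp [hL])), step_sum p q e k (h0 k (by simp)) L (hl L (by simp)).1 (hl L (by simp)).2]
        ring
    exact this _ hg

theorem mem_W (e : Bool) (N : ℕ) (ks : List ℕ) (hN : ∀ k ∈ ks, k < N)
    (L : List (List ℕ)) (hne : ∀ u ∈ L, u ≠ []) (hp : L.flatten.Perm (ks ++ [N]))
    (he : e = true → L.flatten.getLast? = some N) : L ∈ W e N ks := by
  induction ks generalizing L with
  | nil =>
    rw [List.nil_append, List.perm_singleton] at hp
    simp only [W, List.mem_singleton]
    cases L with
    | nil => simp at hp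
    | cons u L =>
      have hu := hne u (by simp)
      rw [List.flatten_cons, List.append_eq_singleton_iff] at hp
      rcases hp with ⟨h, -⟩ | ⟨h1, h2⟩
      · exact absurd h hu
      · subst h1
        cases L with
        | nil => rfl
        | cons v L =>
          have hv := hne v (by simp)
          simp at h2
          exact absurd h2.1 hv
  | cons k ks ih =>
    have hk : k ∈ L.flatten := hp.mem_iff.2 (by simp)
    rw [List.mem_flatten] at hk
    obtain ⟨u, hu, hku⟩ := hk
    obtain ⟨P, Q, rfl⟩ := List.append_of_mem hu
    obtain ⟨a, b, rfl⟩ := List.append_of_mem hku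
    have hp' : (P.flatten ++ a ++ (b ++ Q.flatten)).Perm (ks ++ [N]) := by
      have h1 : (P ++ (a ++ k :: b) :: Q).flatten = P.flatten ++ a ++ k :: (b ++ Q.flatten) := by simp
      rw [h1] at hp
      have := List.perm_middle.symm.trans hp
      exact List.Perm.cons_inv this
    have hkN := hN k (by simp)
    have hlast : e = true → b ++ Q.flatten ≠ [] ∧ (b ++ Q.flatten).getLast? = some N := by
      intro h
      have h2 := he h
      have h1 : (P ++ (a ++ k :: b) :: Q).flatten = (P.flatten ++ a ++ [k]) ++ (b ++ Q.flatten) := by simp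
      rw [h1] at h2
      by_cases h3 : b ++ Q.flatten = []
      · rw [h3] at h2
        simp at h2
        omega
      · refine ⟨h3, ?_⟩
        rwa [List.getLast?_append_of_ne_nil _ h3] at h2
    have hPn : ∀ u ∈ P, u ≠ [] := fun u hu => hne u (by simp [hu])
    have hQn : ∀ u ∈ Q, u ≠ [] := fun u hu => hne u (by simp [hu])
    have hL' : P ++ (seg a ++ (seg b ++ Q)) ∈ W e N ks := by
      have hseg : ∀ c, (seg c).flatten = c := by intro c; by_cases h : c = [] <;> simp [seg, h]
      have hsegn : ∀ c, ∀ u ∈ seg c, u ≠ [] := by intro c; by_cases h : c = [] <;> simp [seg, h]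
      refine ih (fun x hx => hN x (by simp [hx])) _ ?_ ?_ ?_
      · intro u hu
        simp only [List.mem_append] at hu
        rcases hu with hu | hu | hu | hu
        · exact hPn u hu
        · exact hsegn _ u hu
        · exact hsegn _ u hu
        · exact hQn u hu
      · simpa [hseg] using hp'
      · intro h
        obtain ⟨h3, h4⟩ := hlast h
        have : (P ++ (seg a ++ (seg b ++ Q))).flatten = (P.flatten ++ a) ++ (b ++ Q.flatten) := by simp [hseg]
        rw [this, List.getLast?_append_of_ne_nil _ h3, h4]
    have hbQ : e = true → b = [] → Q ≠ [] := by
      intro h hb hQ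
      have := (hlast h).1
      simp [hb, hQ] at this
    rw [W, List.mem_flatMap]
    refine ⟨_, hL', ?_⟩
    simp only [step, List.mem_append, List.mem_map, List.mem_range]
    by_cases ha : a = [] <;> by_cases hb : b = []
    · right; right; right
      refine ⟨P.length, ?_, ?_⟩
      · have := fun h => List.length_pos_iff.2 (hbQ h hb)
        cases e <;> simp [seg, ha, hb] at this ⊢; omega
      · simp [f4, seg, ha, hb]
    · right; left
      refine ⟨P.length, ?_, ?_⟩
      · simp [seg, ha, hb]
      · simp [f2, seg, ha, hb]
    · right; right; left
      refine ⟨P.length, ?_, ?_⟩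
      · have := fun h => List.length_pos_iff.2 (hbQ h hb)
        cases e <;> simp [seg, ha, hb] at this ⊢; omega
      · simp [f3, seg, ha, hb]
    · left
      refine ⟨P.length, ?_, ?_⟩
      · simp [seg, ha, hb]
      · simp [f1, seg, ha, hb]

/-- transfer to a family of words of the right cardinality -/
theorem family_sum {R : Type*} [CommSemiring R] (p q : R) (e : Bool) (N : ℕ) (ks : List ℕ)
    (h0 : ∀ k ∈ ks, 0 < k) (hN : ∀ k ∈ ks, k < N) (hs : ks.Pairwise (· < ·))
    {ι : Type} [Fintype ι] (g : ι → List ℕ) (hg : Function.Injective g)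
    (hp : ∀ i, (g i).Perm (ks ++ [N])) (he : e = true → ∀ i, (g i).getLast? = some N)
    (hc : Fintype.card ι = gf (1 : ℕ) 1 e ks.length 1) :
    ∑ i, wt p q e [g i] = gf p q e ks.length 1 := by
  have key : (Finset.univ.val.map (fun i : ι => [g i])) =
      (((W e N ks).filter (fun L => L.length = 1) : List (List (List ℕ))) : Multiset (List (List ℕ))) := by
    refine Multiset.eq_of_le_of_card_le ?_ ?_
    · rw [Multiset.le_iff_subset]
      · intro L hL
        rw [Multiset.mem_map] at hL
        obtain ⟨i, -, rfl⟩ := hL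
        rw [Multiset.mem_coe, List.mem_filter]
        refine ⟨mem_W e N ks hN _ ?_ (by simpa using hp i) (fun h => by simpa using he h i), by simp⟩
        intro u hu
        rw [List.mem_singleton] at hu
        subst hu
        intro h
        have := (hp i).length_eq
        simp [h] at this
      · exact Finset.univ.nodup.map (fun i j h => hg (by simpa using h))
    · rw [Multiset.coe_card, Multiset.card_map, Finset.card_val, Finset.card_univ, hc,
        ← W_sum 1 1 e N ks h0 hN hs 1]
      refine le_of_eq ?_
      generalize W e N ks = l
      induction l with
      | nil => rfl
      | cons L l ih =>
        rw [List.filter_cons]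
        by_cases h : L.length = 1 <;> simp [h, ind, wt] at ih ⊢ <;> omega
  have h2 := congrArg (fun s => (s.map (wt p q e)).sum) key
  simp only [Multiset.map_map, Multiset.map_coe, Multiset.sum_coe] at h2
  rw [← W_sum p q e N ks h0 hN hs 1]
  refine Eq.trans h2 ?_
  generalize W e N ks = l
  induction l with
  | nil => rfl
  | cons L l ih =>
    rw [List.filter_cons]
    by_cases h : L.length = 1
    · simp [h, ind] at ih ⊢
      rw [ih]
    · simp [h, ind] at ih ⊢
      exact ih

theorem permWord_perm {n : ℕ} (σ : Equiv.Perm (Fin n)) : (permWord σ).Perm (List.range n) := by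
  rw [permWord, List.ofFn_eq_map, ← List.map_coe_finRange_eq_range]
  have : (List.finRange n).map (fun i => (σ i : ℕ)) = ((List.finRange n).map σ).map Fin.val := by
    rw [List.map_map]; rfl
  rw [this]
  exact (Equiv.Perm.map_finRange_perm σ).map _

theorem permWord_inj {n : ℕ} : Function.Injective (permWord (n := n)) := by
  intro σ τ h
  ext i
  have := List.ofFn_injective h
  exact congrFun this i

theorem word_perm {n : ℕ} (σ : Equiv.Perm (Fin n)) :
    ((permWord σ).map (· + 1)).Perm (List.range' 1 n) := by
  have := (permWord_perm σ).map (· + 1)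
  have h2 : (List.range n).map (· + 1) = List.range' 1 n := by
    simp [List.range'_eq_map_range, add_comm]
  rwa [h2] at this

theorem gfA {R : Type*} [CommSemiring R] (p q : R) (n : ℕ) :
    ∑ σ : Equiv.Perm (Fin (n+1)), p ^ tot213 (permWord σ) * q ^ tot312 (permWord σ) = gf p q false n 1 := by
  have h := family_sum p q false (n+1) (List.range' 1 n) (by simp; omega) (by simp; omega)
    (List.pairwise_lt_range') (fun σ : Equiv.Perm (Fin (n+1)) => (permWord σ).map (· + 1))
    (fun σ τ h => permWord_inj (List.map_injective_iff.2 (add_left_injective 1) h))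
    (fun σ => by
      have := word_perm σ
      rwa [List.range'_1_concat, add_comm 1 n] at this) (by simp)
    (by rw [List.length_range', gf_final, (gf_count_true _ 0).1, Fintype.card_perm]; simp)
  rw [List.length_range'] at h
  rw [← h]
  refine Finset.sum_congr rfl fun σ _ => ?_
  rw [wt, (stats_A _).1, (stats_A _).2]

theorem gfB {R : Type*} [CommSemiring R] (p q : R) (n : ℕ) :
    ∑ σ : Equiv.Perm (Fin n), p ^ tot231 (permWord σ) * q ^ tot312 (permWord σ) = gf p q true n 1 := by
  have h := family_sum p q true (n+1) (List.range' 1 n) (by simp; omega) (by simp; omega)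
    (List.pairwise_lt_range') (fun σ : Equiv.Perm (Fin n) => (permWord σ).map (· + 1) ++ [n+1])
    (fun σ τ h => permWord_inj (List.map_injective_iff.2 (add_left_injective 1) (List.append_cancel_right h)))
    (fun σ => (word_perm σ).append_right _) (by simp)
    (by rw [List.length_range', (gf_count_true _ 0).1, Fintype.card_perm]; simp)
  rw [List.length_range'] at h
  rw [← h]
  refine Finset.sum_congr rfl fun σ _ => ?_
  have hw : ∀ x ∈ permWord σ, x < n := fun x hx => by
    have := (permWord_perm σ).mem_iff.1 hx
    simpa using this
  rw [wt, (stats_B _ n hw).1, (stats_B _ n hw).2]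

open Polynomial in
theorem extract {ι : Type} [Fintype ι] (s t : ι → ℕ) (a b : ℕ) :
    ((∑ i, (X : (ℕ[X])[X]) ^ s i * (C (X : ℕ[X])) ^ t i).coeff a).coeff b =
      (Finset.univ.filter fun i => s i = a ∧ t i = b).card := by
  rw [Finset.card_filter, finset_sum_coeff, finset_sum_coeff]
  refine Finset.sum_congr rfl fun i _ => ?_
  rw [← C_pow, coeff_mul_C, coeff_X_pow]
  by_cases h1 : a = s i <;> by_cases h2 : b = t i <;> simp [h1, h2, coeff_X_pow, eq_comm] <;> tauto

end Vinc

/-- **Equidistribution of vincular pattern pairs** (Proposition 6.4): for every `n` and all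
`a, b`, the number of permutations of `[n]` with `(2–13)(σ) = a` and `(31–2)(σ) = b` equals
the number of permutations of `[n]` with `(2–31)(σ) = a` and `(31–2)(σ) = b`. -/
theorem equidistribution_213_231_with_312 (n a b : ℕ) :
    (Finset.univ.filter fun σ : Equiv.Perm (Fin n) =>
        tot213 (permWord σ) = a ∧ tot312 (permWord σ) = b).card =
      (Finset.univ.filter fun σ : Equiv.Perm (Fin n) =>
        tot231 (permWord σ) = a ∧ tot312 (permWord σ) = b).card := by
  cases n with
  | zero =>
    congr 1
  | succ n =>
    have h := (Vinc.gfA (Polynomial.X : Polynomial (Polynomial ℕ)) (Polynomial.C Polynomial.X) n).trans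
      ((Vinc.gf_final _ _ n).trans (Vinc.gfB _ _ (n+1)).symm)
    have h' := congrArg (fun f => (f.coeff a).coeff b) h
    simp only [Vinc.extract] at h'
    convert h' using 2
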